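/- With the needle-in-haystack construction below, there exists a constant C > 0, depending only on d, ζ and h (and not on ε, w, j or M), such that for every region index j ∈ {1,…,M}: Σ_{m=1}^M (v̄_m^j)² ≤ C·ε². -/

import Mathlib

open MeasureTheory Real

noncomputable section

/-- The `d`-dimensional bump function `H(ξ) = exp(−1/(1−‖ξ‖₂²))` for `‖ξ‖₂ < 1`, `0` otherwise. -/
def bumpH (d : ℕ) (ξ : Fin d → ℝ) : ℝ :=
  if (∑ i, ξ i ^ 2) < 1 then Real.exp (-1 / (1 - ∑ i, ξ i ^ 2)) else 0

/-- The inverse Fourier transform of `bumpH`, as a complex number: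
`∫ H(ξ) e^{2πi⟨x,ξ⟩} dξ`. -/
def bumphC (d : ℕ) (x : Fin d → ℝ) : ℂ :=
  ∫ ξ : Fin d → ℝ, (bumpH d ξ : ℂ) * Complex.exp (2 * Real.pi * Complex.I * (∑ i, x i * ξ i))

/-- The inverse Fourier transform `h` of the bump function `H` (real-valued since `H` is real
and even). -/
def bumph (d : ℕ) (x : Fin d → ℝ) : ℝ :=
  (bumphC d x).re

/-- The cube of the uniform axis-aligned grid of step `w` indexed by `j ∈ {0,…,K−1}^d`. -/
def gridCube {d K : ℕ} (w : ℝ) (j : Fin d → Fin K) : Set (Fin d → ℝ) :=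
  Set.Icc (fun l => (j l : ℝ) * w) (fun l => ((j l : ℝ) + 1) * w)

/-- The center of the grid cube indexed by `j`. -/
def gridCenter {d K : ℕ} (w : ℝ) (j : Fin d → Fin K) : Fin d → ℝ :=
  fun l => ((j l : ℝ) + 1 / 2) * w

/-- The needle function `f_m(x) = g(x − c_m)` with `g(x) = (2ε/h(0)) h(xζ/w)`. -/
def needle (d : ℕ) (ζ ε w : ℝ) (c : Fin d → ℝ) (x : Fin d → ℝ) : ℝ :=
  (2 * ε / bumph d 0) * bumph d (fun l => (x l - c l) * ζ / w)

/-- `v̄_m^j = sup_{x ∈ R_j} f_m(x)` for the needle construction. -/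
def vbar {d K : ℕ} (ζ ε w : ℝ) (m j : Fin d → Fin K) : ℝ :=
  sSup (needle d ζ ε w (gridCenter w m) '' gridCube w j)

end

open scoped FourierTransform SchwartzMap ContDiff

lemma bumpH_eq_expNegInvGlue (d : ℕ) (ξ : EuclideanSpace ℝ (Fin d)) :
    bumpH d ξ = expNegInvGlue (1 - ‖ξ‖ ^ 2) := by
  simp only [bumpH, expNegInvGlue, EuclideanSpace.real_norm_sq_eq]
  by_cases h : ∑ i, ξ i ^ 2 < 1
  · rw [if_pos h, if_neg (by linarith), neg_div, one_div]
  · rw [if_neg h, if_pos (by linarith)]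

lemma contDiff_ofReal_bumpH (d : ℕ) :
    ContDiff ℝ ∞ fun ξ : EuclideanSpace ℝ (Fin d) => (bumpH d ξ : ℂ) := by
  simp only [bumpH_eq_expNegInvGlue]
  exact Complex.ofRealCLM.contDiff.comp
    (expNegInvGlue.contDiff.comp (contDiff_const.sub (contDiff_norm_sq ℝ)))

lemma hasCompactSupport_ofReal_bumpH (d : ℕ) :
    HasCompactSupport fun ξ : EuclideanSpace ℝ (Fin d) => (bumpH d ξ : ℂ) := by
  refine HasCompactSupport.intro (isCompact_closedBall 0 1) fun ξ hξ => ?_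
  have h : 1 < ‖ξ‖ := by simpa using hξ
  rw [bumpH_eq_expNegInvGlue, expNegInvGlue.zero_of_nonpos (by nlinarith), Complex.ofReal_zero]

/-- The bump function as a Schwartz function on Euclidean space. -/
noncomputable def bumpSchwartz (d : ℕ) : 𝓢(EuclideanSpace ℝ (Fin d), ℂ) :=
  (hasCompactSupport_ofReal_bumpH d).toSchwartzMap (contDiff_ofReal_bumpH d)

lemma bumphC_eq_fourierInv (d : ℕ) (x : Fin d → ℝ) :
    bumphC d x = (𝓕⁻ (bumpSchwartz d)) (WithLp.toLp 2 x) := by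
  rw [SchwartzMap.fourierInv_coe, Real.fourierInv_eq', bumphC,
    ← (PiLp.volume_preserving_ofLp (Fin d)).integral_comp
      (MeasurableEquiv.toLp 2 (Fin d → ℝ)).symm.measurableEmbedding]
  refine integral_congr_ae (Filter.Eventually.of_forall fun ξ => ?_)
  simp only [bumpSchwartz, HasCompactSupport.toSchwartzMap_toFun, smul_eq_mul,
    PiLp.inner_apply, RCLike.inner_apply, conj_trivial]
  rw [mul_comm]
  congr 2
  push_cast
  ring

lemma exists_bumph_decay (d : ℕ) :
    ∃ A : ℝ, ∀ x : Fin d → ℝ, (∏ i, (1 + |x i|)) * |bumph d x| ≤ A := by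
  refine ⟨2 ^ d * (Finset.Iic (d, 0)).sup (fun m => SchwartzMap.seminorm ℂ m.1 m.2)
    (𝓕⁻ (bumpSchwartz d)), fun x => ?_⟩
  have h := SchwartzMap.one_add_le_sup_seminorm_apply (𝕜 := ℂ) (m := (d, 0)) le_rfl le_rfl
    (𝓕⁻ (bumpSchwartz d)) (WithLp.toLp 2 x)
  rw [norm_iteratedFDeriv_zero, ← bumphC_eq_fourierInv] at h
  refine le_trans (mul_le_mul ?_ (Complex.abs_re_le_norm _) (abs_nonneg _) (by positivity)) h
  refine (Finset.prod_le_prod (fun _ _ => by positivity) fun i _ =>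
    add_le_add_right (PiLp.norm_apply_le (WithLp.toLp 2 x) i) 1).trans_eq ?_
  simp

lemma summable_int_one_add_abs_inv_sq : Summable fun n : ℤ => ((1 + |(n : ℝ)|) ^ 2)⁻¹ := by
  have h : Summable fun n : ℕ => (((1 : ℝ) + n) ^ 2)⁻¹ := by
    simpa [add_comm] using
      (summable_nat_add_iff 1).2 (Real.summable_nat_pow_inv.2 (one_lt_two))
  exact .of_nat_of_neg (by simpa using h) (by simpa using h)

lemma sum_fin_one_add_abs_sub_inv_sq_le {K : ℕ} (j : Fin K) :
    ∑ m : Fin K, ((1 + |(j : ℝ) - m|) ^ 2)⁻¹ ≤ ∑' n : ℤ, ((1 + |(n : ℝ)|) ^ 2)⁻¹ := by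
  have hinj : Function.Injective fun m : Fin K => (j : ℤ) - m := fun a b h => by
    ext; simp only at h; omega
  have h := summable_int_one_add_abs_inv_sq.sum_le_tsum
    (Finset.univ.map ⟨_, hinj⟩) fun _ _ => by positivity
  simpa using h

lemma sum_pi_prod_le {d K : ℕ} (j : Fin d → Fin K) :
    ∑ m : Fin d → Fin K, ∏ i, ((1 + |(j i : ℝ) - m i|) ^ 2)⁻¹ ≤
      (∑' n : ℤ, ((1 + |(n : ℝ)|) ^ 2)⁻¹) ^ d := by
  have h := Finset.prod_univ_sum (fun _ : Fin d => (Finset.univ : Finset (Fin K)))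
    fun i m => ((1 + |(j i : ℝ) - m|) ^ 2)⁻¹
  rw [Fintype.piFinset_univ] at h
  rw [← h]
  refine (Finset.prod_le_prod (fun _ _ => by positivity) fun i _ =>
    sum_fin_one_add_abs_sub_inv_sq_le (j i)).trans_eq ?_
  simp

lemma min_div_four_mul_le {ζ t : ℝ} (hζ : 0 < ζ) {k : ℤ} (ht : |t| ≤ 1 / 2) :
    min 1 ζ / 4 * (1 + |(k : ℝ)|) ≤ 1 + |((k : ℝ) + t) * ζ| := by
  have h1 := min_le_left 1 ζ
  have h2 := min_le_right 1 ζ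
  have h3 : 0 < min 1 ζ := lt_min one_pos hζ
  rcases eq_or_ne k 0 with rfl | hk
  · have := abs_nonneg (((0 : ℤ) + t) * ζ)
    simp only [Int.cast_zero, abs_zero] at *
    linarith
  · have hk1 : (1 : ℝ) ≤ |(k : ℝ)| := by exact_mod_cast Int.one_le_abs hk
    have hkt : |(k : ℝ)| - 1 / 2 ≤ |(k : ℝ) + t| := by
      have := abs_sub_abs_le_abs_sub (k : ℝ) (-t)
      rw [abs_neg, sub_neg_eq_add] at this
      linarith
    rw [abs_mul, abs_of_pos hζ]
    nlinarith

lemma abs_needle_le {d K : ℕ} {ζ A ε w : ℝ} (hζ : 0 < ζ)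
    (hA : ∀ x : Fin d → ℝ, (∏ i, (1 + |x i|)) * |bumph d x| ≤ A) (hw : 0 < w)
    (m j : Fin d → Fin K) {x : Fin d → ℝ} (hx : x ∈ gridCube w j) :
    |needle d ζ ε w (gridCenter w m) x| ≤
      |2 * ε / bumph d 0| * (A * ∏ i, (min 1 ζ / 4 * (1 + |(j i : ℝ) - m i|))⁻¹) := by
  have hc : 0 < min 1 ζ / 4 := div_pos (lt_min one_pos hζ) four_pos
  rw [needle, abs_mul]
  gcongr
  set y : Fin d → ℝ := fun l => (x l - gridCenter w m l) * ζ / w with hy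
  have hle : ∏ i, (min 1 ζ / 4 * (1 + |(j i : ℝ) - m i|)) ≤ ∏ i, (1 + |y i|) := by
    refine Finset.prod_le_prod (fun _ _ => by positivity) fun i _ => ?_
    have h1 := hx.1 i
    have h2 := hx.2 i
    have hyi : y i = ((((j i : ℤ) - (m i : ℤ) : ℤ) : ℝ) + (x i / w - j i - 1 / 2)) * ζ := by
      simp only [hy, gridCenter]
      push_cast
      field_simp
      ring
    have h3 : (j i : ℝ) ≤ x i / w := (le_div_iff₀ hw).2 h1
    have h4 : x i / w ≤ j i + 1 := (div_le_iff₀ hw).2 h2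
    rw [hyi]
    simpa using min_div_four_mul_le hζ (k := (j i : ℤ) - (m i : ℤ))
      (t := x i / w - j i - 1 / 2) (abs_le.2 ⟨by linarith, by linarith⟩)
  have hpos : 0 < ∏ i, (min 1 ζ / 4 * (1 + |(j i : ℝ) - m i|)) :=
    Finset.prod_pos fun _ _ => by positivity
  rw [Finset.prod_inv_distrib, ← div_eq_mul_inv, le_div_iff₀ hpos, mul_comm]
  exact (mul_le_mul_of_nonneg_right hle (abs_nonneg _)).trans (hA y)

lemma abs_csSup_image_le {α : Type*} {f : α → ℝ} {s : Set α} {B : ℝ} (hs : s.Nonempty)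
    (h : ∀ x ∈ s, |f x| ≤ B) : |sSup (f '' s)| ≤ B := by
  obtain ⟨x, hx⟩ := hs
  have hub : ∀ y ∈ f '' s, y ≤ B := by
    rintro _ ⟨y, hy, rfl⟩
    exact (abs_le.1 (h y hy)).2
  exact abs_le.2 ⟨(abs_le.1 (h x hx)).1.trans (le_csSup ⟨B, hub⟩ ⟨x, hx, rfl⟩),
    csSup_le ⟨_, x, hx, rfl⟩ hub⟩

lemma gridCube_nonempty {d K : ℕ} {w : ℝ} (hw : 0 < w) (j : Fin d → Fin K) :
    (gridCube w j).Nonempty :=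
  Set.nonempty_Icc.2 fun l => mul_le_mul_of_nonneg_right (by simp) hw.le

lemma vbar_sq_le {d K : ℕ} {ζ A ε w : ℝ} (hζ : 0 < ζ)
    (hA : ∀ x : Fin d → ℝ, (∏ i, (1 + |x i|)) * |bumph d x| ≤ A) (hw : 0 < w)
    (m j : Fin d → Fin K) :
    vbar ζ ε w m j ^ 2 ≤
      (2 / bumph d 0 * A * ((min 1 ζ / 4)⁻¹) ^ d) ^ 2 * ε ^ 2 *
        ∏ i, ((1 + |(j i : ℝ) - m i|) ^ 2)⁻¹ := by
  have h := abs_csSup_image_le (gridCube_nonempty hw j)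
    fun x hx => abs_needle_le (ε := ε) hζ hA hw m j hx
  refine (sq_le_sq.2 (h.trans (le_abs_self _))).trans_eq ?_
  rw [mul_pow, sq_abs]
  simp only [mul_inv, Finset.prod_mul_distrib, Finset.prod_const, Finset.card_univ,
    Fintype.card_fin, inv_pow, Finset.prod_inv_distrib, Finset.prod_pow]
  ring

/-- Lemma 5, part 3: in the needle-in-haystack construction,
`Σ_{m=1}^M (v̄_m^j)² ≤ C·ε²` for a constant `C` depending only on `d`, `ζ` and `h`. -/
theorem sum_over_needles_vbar_sq_le (d : ℕ) (hd : 1 ≤ d) (ζ : ℝ) (hζ : 0 < ζ)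
    (hζprop : ∀ x : Fin d → ℝ, (∃ i, ζ < |x i|) → |bumph d x| < bumph d 0 / 2) :
    ∃ C > (0 : ℝ), ∀ ε w : ℝ, 0 < ε → 0 < w → w < 1 →
      ∀ j : Fin d → Fin (Nat.floor (1 / w)),
        ∑ m : Fin d → Fin (Nat.floor (1 / w)), vbar ζ ε w m j ^ 2 ≤ C * ε ^ 2 := by
  obtain ⟨A, hA⟩ := exists_bumph_decay d
  set D := (2 / bumph d 0 * A * ((min 1 ζ / 4)⁻¹) ^ d) ^ 2
  set S := (∑' n : ℤ, ((1 + |(n : ℝ)|) ^ 2)⁻¹) ^ d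
  have hS : 0 ≤ S := pow_nonneg (tsum_nonneg fun _ => by positivity) d
  refine ⟨D * S + 1, by positivity, fun ε w _ hw _ j => ?_⟩
  calc ∑ m, vbar ζ ε w m j ^ 2
      ≤ ∑ m, D * ε ^ 2 * ∏ i, ((1 + |(j i : ℝ) - m i|) ^ 2)⁻¹ :=
        Finset.sum_le_sum fun m _ => vbar_sq_le hζ hA hw m j
    _ ≤ D * ε ^ 2 * S := by
        rw [← Finset.mul_sum]
        exact mul_le_mul_of_nonneg_left (sum_pi_prod_le j) (by positivity)
    _ ≤ (D * S + 1) * ε ^ 2 := by nlinarith [sq_nonneg ε]
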